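/- Suppose the action of G_A on Y is regular, let ω ∈ Ω̂, and let a ∈ G_A be an element of order 2 with a(1) = q. For j ∈ ℕ set K_{j,a} = {b ∈ G_B : ω_j(b) = a}, and let I = {1} ∪ {i > 1 : ω₁ = ω_i and ω_{i−1} ≠ ω_i}. Assume: I is infinite; the difference between any two consecutive indices in I is at most r; K_{1,a} ∩ K_{j,a} ≠ ∅ for all j > 1; and Ker(ω₁) ∩ K_{j−1,a} ≠ ∅ for all j ∈ I with j > 1. Then the period growth function of G_ω satisfies n^{1/(r−1)} ≾ π_ω(n). -/

import Mathlib

noncomputable section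

open Equiv

namespace Spinal

/-- The letter `q` of the alphabet `{1,…,q}` (here `q = m + 2`). -/
def qtop (m : ℕ) : Fin (m + 2) := Fin.last (m + 1)

/-- The letter `1` of the alphabet. -/
def qone (m : ℕ) : Fin (m + 2) := 0


theorem qone_ne_qtop (m : ℕ) : qone m ≠ qtop m := by
  simp [qone, qtop, Fin.ext_iff]

/-- The action of an alphabet permutation on the first letter of a word. -/
def rootFun (m : ℕ) (a : Equiv.Perm (Fin (m + 2))) :
    List (Fin (m + 2)) → List (Fin (m + 2))
  | [] => []
  | y :: w => a y :: w

theorem rootFun_leftInv (m : ℕ) (a : Equiv.Perm (Fin (m + 2))) (w : List (Fin (m + 2))) :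
    rootFun m a.symm (rootFun m a w) = w := by
  cases w <;> simp [rootFun]

/-- The tree automorphism induced by a root permutation. -/
def rootAut (m : ℕ) (a : Equiv.Perm (Fin (m + 2))) : Equiv.Perm (List (Fin (m + 2))) where
  toFun := rootFun m a
  invFun := rootFun m a.symm
  left_inv w := rootFun_leftInv m a w
  right_inv w := by simpa using rootFun_leftInv m a.symm w

variable {GB : Type*} [Group GB]

/-- The spinal action of `b : G_B` determined by the sequence `ω` of homomorphisms:
at the vertex `q^n 1` the next letter is moved by `ω n b` (0-indexed, so `ω 0` is the
paper's `ω₁`). -/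
def spinalFun (m : ℕ) (ω : ℕ → GB →* Equiv.Perm (Fin (m + 2))) (b : GB) :
    ℕ → List (Fin (m + 2)) → List (Fin (m + 2))
  | _, [] => []
  | n, y :: w =>
    if y = qtop m then y :: spinalFun m ω b (n + 1) w
    else if y = qone m then
      y :: (match w with
            | [] => []
            | z :: w' => ω n b z :: w')
    else y :: w

theorem spinalFun_leftInv (m : ℕ) (ω : ℕ → GB →* Equiv.Perm (Fin (m + 2)))
    (b : GB) (n : ℕ) (w : List (Fin (m + 2))) :
    spinalFun m ω b⁻¹ n (spinalFun m ω b n w) = w := by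
  induction w generalizing n with
  | nil => simp [spinalFun]
  | cons y w ih =>
    by_cases h1 : y = qtop m
    · simp [spinalFun, h1, ih]
    · by_cases h2 : y = qone m
      · match w with
        | [] => simp [spinalFun, h1, h2]
        | z :: w' => simp [spinalFun, h1, h2, map_inv, qone_ne_qtop]
      · simp [spinalFun, h1, h2]

/-- The tree automorphism induced by `b : G_B` via the sequence `ω`. -/
def spinalAut (m : ℕ) (ω : ℕ → GB →* Equiv.Perm (Fin (m + 2))) (b : GB) :
    Equiv.Perm (List (Fin (m + 2))) where
  toFun := spinalFun m ω b 0
  invFun := spinalFun m ω b⁻¹ 0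
  left_inv w := spinalFun_leftInv m ω b 0 w
  right_inv w := by simpa using spinalFun_leftInv m ω b⁻¹ 0 w

/-- The canonical generating set `S_ω = A ∪ B_ω` (non-identity induced automorphisms). -/
def genSet (m : ℕ) (GA : Subgroup (Equiv.Perm (Fin (m + 2))))
    (ω : ℕ → GB →* Equiv.Perm (Fin (m + 2))) : Set (Equiv.Perm (List (Fin (m + 2)))) :=
  ((rootAut m '' (GA : Set (Equiv.Perm (Fin (m + 2))))) ∪
    Set.range fun b : GB => spinalAut m ω b) \ {1}

/-- The spinal group `G_ω`, as a subgroup of the permutation group of the vertex set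
of the `(m+2)`-regular rooted tree. -/
def spinalGroup (m : ℕ) (GA : Subgroup (Equiv.Perm (Fin (m + 2))))
    (ω : ℕ → GB →* Equiv.Perm (Fin (m + 2))) : Subgroup (Equiv.Perm (List (Fin (m + 2)))) :=
  Subgroup.closure (genSet m GA ω)

/-- The defining conditions on the data `(G_A, G_B, ω)` of a spinal group:
`G_A` is a transitive (hence faithful) group of permutations of the alphabet,
every `ω n` is an epimorphism onto `G_A`, and `ω ∈ Ω̂`: from every index on, the kernels
of the remaining homomorphisms cover `G_B` and intersect trivially. -/
structure SpinalData (m : ℕ) (GA : Subgroup (Equiv.Perm (Fin (m + 2))))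
    (ω : ℕ → GB →* Equiv.Perm (Fin (m + 2))) : Prop where
  transitive : ∀ i j : Fin (m + 2), ∃ a ∈ GA, a i = j
  range_eq : ∀ n, (ω n).range = GA
  kernels_cover : ∀ i : ℕ, ∀ b : GB, ∃ j, i ≤ j ∧ ω j b = 1
  kernels_sep : ∀ i : ℕ, ∀ b : GB, (∀ j, i ≤ j → ω j b = 1) → b = 1

/-- Word length of a group element with respect to a set of generators. -/
def wordLength {G : Type*} [Group G] (S : Set G) (g : G) : ℕ :=
  sInf {n | ∃ l : List G, l.length = n ∧ (∀ x ∈ l, x ∈ S) ∧ l.prod = g}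

/-- The word growth function `γ_ω` of the spinal group with respect to `S_ω`. -/
def growth (m : ℕ) (GA : Subgroup (Equiv.Perm (Fin (m + 2))))
    (ω : ℕ → GB →* Equiv.Perm (Fin (m + 2))) (n : ℕ) : ℕ :=
  Nat.card {g : Equiv.Perm (List (Fin (m + 2))) //
    g ∈ spinalGroup m GA ω ∧ wordLength (genSet m GA ω) g ≤ n}

/-- The period growth function `π_ω`: the largest order of an element of word length
at most `n`. -/
def periodGrowth (m : ℕ) (GA : Subgroup (Equiv.Perm (Fin (m + 2))))
    (ω : ℕ → GB →* Equiv.Perm (Fin (m + 2))) (n : ℕ) : ℕ :=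
  sSup (orderOf '' {g : Equiv.Perm (List (Fin (m + 2))) |
    g ∈ spinalGroup m GA ω ∧ wordLength (genSet m GA ω) g ≤ n})

/-- Abstract letters for words over `S_ω`: an `A`-letter is (induced by) a permutation
of the alphabet, a `B`-letter is (induced by) an element of `G_B`. -/
abbrev Letter (m : ℕ) (GB : Type*) := Equiv.Perm (Fin (m + 2)) ⊕ GB

/-- Evaluation of an abstract letter as a tree automorphism. -/
def evalLetter (m : ℕ) (ω : ℕ → GB →* Equiv.Perm (Fin (m + 2))) :
    Letter m GB → Equiv.Perm (List (Fin (m + 2))) :=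
  Sum.elim (rootAut m) (spinalAut m ω)

/-- The list of `A`-letters of a word, in order. -/
def aLetters {m : ℕ} {GB : Type*} : List (Letter m GB) → List (Equiv.Perm (Fin (m + 2))) :=
  List.filterMap fun x => match x with
    | Sum.inl a => some a
    | Sum.inr _ => none

/-- The list of `B`-letters of a word, in order. -/
def bLetters {m : ℕ} {GB : Type*} : List (Letter m GB) → List GB :=
  List.filterMap fun x => match x with
    | Sum.inl _ => none
    | Sum.inr b => some b

/-- A word is reduced if its letters alternate between `A`-letters and `B`-letters and
no letter is the identity. -/
def IsReduced {m : ℕ} (F : List (Letter m GB)) : Prop :=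
  List.Chain' (fun x y => x.isLeft ≠ y.isLeft) F ∧
    Sum.inl (1 : Equiv.Perm (Fin (m + 2))) ∉ F ∧ Sum.inr (1 : GB) ∉ F

open scoped Classical in
/-- One step of the (complete, confluent) simple reduction process: prepend a letter to an
already reduced word and reduce. -/
def reduceStep {m : ℕ} : Letter m GB → List (Letter m GB) → List (Letter m GB)
  | Sum.inl a, [] => if a = 1 then [] else [Sum.inl a]
  | Sum.inr b, [] => if b = 1 then [] else [Sum.inr b]
  | Sum.inl a, Sum.inl a' :: t => if a * a' = 1 then t else Sum.inl (a * a') :: t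
  | Sum.inr b, Sum.inr b' :: t => if b * b' = 1 then t else Sum.inr (b * b') :: t
  | Sum.inl a, y :: t => if a = 1 then y :: t else Sum.inl a :: y :: t
  | Sum.inr b, y :: t => if b = 1 then y :: t else Sum.inr b :: y :: t

/-- The reduced form of a word, obtained by simple reductions. -/
def reduceWord {m : ℕ} (F : List (Letter m GB)) : List (Letter m GB) :=
  F.foldr reduceStep []

open scoped Classical in
/-- The (unreduced) projection of a word, representing an element of the first-level
stabilizer, to the coordinate `i` of the first level: scanning the word from the left
while accumulating the product `g` of the `A`-letters, a `B`-letter `b` contributes the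
letter `b` at the coordinate `g(q)` and the letter `ω₁(b)` at the coordinate `g(1)`. -/
def projWord (m : ℕ) (ω0 : GB →* Equiv.Perm (Fin (m + 2))) (i : Fin (m + 2)) :
    List (Letter m GB) → Equiv.Perm (Fin (m + 2)) → List (Letter m GB)
  | [], _ => []
  | Sum.inl a :: F, g => projWord m ω0 i F (g * a)
  | Sum.inr b :: F, g =>
      ((if g (qtop m) = i then [Sum.inr b] else []) ++
        (if g (qone m) = i then [Sum.inl (ω0 b)] else [])) ++ projWord m ω0 i F g

/-- The list of the `q^r` (reduced) words at level `r` of the depth-`r` decomposition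
of a word. -/
def levelWords (m : ℕ) :
    (ℕ → GB →* Equiv.Perm (Fin (m + 2))) → ℕ → List (Letter m GB) →
      List (List (Letter m GB))
  | _, 0, F => [F]
  | ω, r + 1, F =>
      (List.finRange (m + 2)).flatMap fun i =>
        levelWords m (fun n => ω (n + 1)) r (reduceWord (projWord m (ω 0) i F 1))

/-- `|L_r(F)|`: the total length of level `r` of the depth-`r` decomposition of `F`. -/
def levelLength (m : ℕ) (ω : ℕ → GB →* Equiv.Perm (Fin (m + 2))) (r : ℕ)
    (F : List (Letter m GB)) : ℕ :=
  ((levelWords m ω r F).map List.length).sum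

/-- The triangular weight of a letter: `A`-letters have weight `τ₀ = 1 - η^r`; a
`B`-letter `b` has weight `τ_i = η^r + η^(r-i) - 1` where `i` is the smallest (1-based)
index with `ω_i(b) = 1`. -/
def letterWeight (m : ℕ) (ω : ℕ → GB →* Equiv.Perm (Fin (m + 2))) (η : ℝ) (r : ℕ) :
    Letter m GB → ℝ
  | Sum.inl _ => 1 - η ^ r
  | Sum.inr b => η ^ r + η ^ (r - (sInf {j | ω j b = 1} + 1)) - 1

/-- The total triangular weight of a word. -/
def wordWeight (m : ℕ) (ω : ℕ → GB →* Equiv.Perm (Fin (m + 2))) (η : ℝ) (r : ℕ)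
    (F : List (Letter m GB)) : ℝ :=
  (F.map (letterWeight m ω η r)).sum

/-- The weight `∂^τ(g)` of a group element: the least total weight of a word over `S_ω`
representing it. -/
def elemWeight (m : ℕ) (GA : Subgroup (Equiv.Perm (Fin (m + 2))))
    (ω : ℕ → GB →* Equiv.Perm (Fin (m + 2))) (η : ℝ) (r : ℕ)
    (g : Equiv.Perm (List (Fin (m + 2)))) : ℝ :=
  sInf {x : ℝ | ∃ F : List (Letter m GB),
    (∀ a : Equiv.Perm (Fin (m + 2)), Sum.inl a ∈ F → a ∈ GA) ∧
    (F.map (evalLetter m ω)).prod = g ∧ wordWeight m ω η r F = x}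

/-- The action on the first letter, as a homomorphism. -/
def rootHom (m : ℕ) : Equiv.Perm (Fin (m + 2)) →* Equiv.Perm (List (Fin (m + 2))) where
  toFun := rootAut m
  map_one' := by
    ext1 w
    cases w <;> rfl
  map_mul' a b := by
    ext1 w
    cases w <;> rfl

theorem rootHom_cons (m : ℕ) (a : Equiv.Perm (Fin (m + 2))) (y : Fin (m + 2))
    (w : List (Fin (m + 2))) : rootHom m a (y :: w) = a y :: w := rfl

theorem rootHom_nil (m : ℕ) (a : Equiv.Perm (Fin (m + 2))) : rootHom m a [] = [] := rfl

theorem spinalFun_qtop (m : ℕ) (ω : ℕ → GB →* Equiv.Perm (Fin (m + 2))) (b : GB) (n : ℕ)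
    (w : List (Fin (m + 2))) :
    spinalFun m ω b n (qtop m :: w) = qtop m :: spinalFun m ω b (n + 1) w := by
  simp [spinalFun]

theorem spinalFun_qone (m : ℕ) (ω : ℕ → GB →* Equiv.Perm (Fin (m + 2))) (b : GB) (n : ℕ)
    (w : List (Fin (m + 2))) :
    spinalFun m ω b n (qone m :: w) = qone m :: rootHom m (ω n b) w := by
  cases w <;> simp [spinalFun, qone_ne_qtop, rootHom_cons, rootHom_nil]

theorem spinalFun_of_ne (m : ℕ) (ω : ℕ → GB →* Equiv.Perm (Fin (m + 2))) (b : GB) (n : ℕ)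
    {y : Fin (m + 2)} (h₁ : y ≠ qtop m) (h₂ : y ≠ qone m) (w : List (Fin (m + 2))) :
    spinalFun m ω b n (y :: w) = y :: w := by
  simp [spinalFun, h₁, h₂]

theorem spinalFun_one (m : ℕ) (ω : ℕ → GB →* Equiv.Perm (Fin (m + 2))) (n : ℕ)
    (w : List (Fin (m + 2))) : spinalFun m ω 1 n w = w := by
  induction w generalizing n with
  | nil => rfl
  | cons y w ih =>
    by_cases h₁ : y = qtop m
    · subst h₁
      rw [spinalFun_qtop, ih]
    · by_cases h₂ : y = qone m
      · subst h₂
        rw [spinalFun_qone, map_one, map_one, Equiv.Perm.one_apply]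
      · rw [spinalFun_of_ne m ω 1 n h₁ h₂]

theorem spinalFun_mul (m : ℕ) (ω : ℕ → GB →* Equiv.Perm (Fin (m + 2))) (b c : GB) (n : ℕ)
    (w : List (Fin (m + 2))) :
    spinalFun m ω (b * c) n w = spinalFun m ω b n (spinalFun m ω c n w) := by
  induction w generalizing n with
  | nil => rfl
  | cons y w ih =>
    by_cases h₁ : y = qtop m
    · subst h₁
      rw [spinalFun_qtop, spinalFun_qtop, spinalFun_qtop, ih]
    · by_cases h₂ : y = qone m
      · subst h₂
        rw [spinalFun_qone, spinalFun_qone, spinalFun_qone, map_mul, map_mul,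
          Equiv.Perm.mul_apply]
      · rw [spinalFun_of_ne m ω _ n h₁ h₂, spinalFun_of_ne m ω _ n h₁ h₂,
          spinalFun_of_ne m ω _ n h₁ h₂]

/-- The spinal action of `G_B` determined by the sequence `ω` shifted by `n`. -/
def levelHom (m : ℕ) (ω : ℕ → GB →* Equiv.Perm (Fin (m + 2))) (n : ℕ) :
    GB →* Equiv.Perm (List (Fin (m + 2))) where
  toFun b :=
    { toFun := spinalFun m ω b n
      invFun := spinalFun m ω b⁻¹ n
      left_inv := fun w => spinalFun_leftInv m ω b n w
      right_inv := fun w => by simpa using spinalFun_leftInv m ω b⁻¹ n w }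
  map_one' := by
    ext1 w
    exact spinalFun_one m ω n w
  map_mul' b c := by
    ext1 w
    exact spinalFun_mul m ω b c n w

section Action

variable (m : ℕ) (ω : ℕ → GB →* Equiv.Perm (Fin (m + 2)))

theorem levelHom_qtop (n : ℕ) (b : GB) (w : List (Fin (m + 2))) :
    levelHom m ω n b (qtop m :: w) = qtop m :: levelHom m ω (n + 1) b w :=
  spinalFun_qtop m ω b n w

theorem levelHom_qone (n : ℕ) (b : GB) (w : List (Fin (m + 2))) :
    levelHom m ω n b (qone m :: w) = qone m :: rootHom m (ω n b) w :=
  spinalFun_qone m ω b n w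

theorem levelHom_of_ne (n : ℕ) (b : GB) {y : Fin (m + 2)} (h₁ : y ≠ qtop m) (h₂ : y ≠ qone m)
    (w : List (Fin (m + 2))) : levelHom m ω n b (y :: w) = y :: w :=
  spinalFun_of_ne m ω b n h₁ h₂ w

/-- The tree automorphism represented by a word, for the sequence `ω` shifted by `n`. -/
def evalWord (n : ℕ) (F : List (Letter m GB)) : Equiv.Perm (List (Fin (m + 2))) :=
  (F.map (Sum.elim (rootHom m) (levelHom m ω n))).prod

/-- The permutation of the first level induced by a word. -/
def rootPerm (F : List (Letter m GB)) : Equiv.Perm (Fin (m + 2)) :=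
  (F.map (Sum.elim id fun _ => 1)).prod

/-- The section of a letter at the vertex `y` of the first level. -/
def letterSection (n : ℕ) (y : Fin (m + 2)) : Letter m GB → List (Letter m GB)
  | Sum.inl _ => []
  | Sum.inr b =>
    (if y = qtop m then [Sum.inr b] else []) ++
      (if y = qone m then [Sum.inl (ω n b)] else [])

/-- The section of a word at the vertex `y` of the first level. -/
def wordSection (n : ℕ) (y : Fin (m + 2)) : List (Letter m GB) → List (Letter m GB)
  | [] => []
  | x :: F => letterSection m ω n (rootPerm m F y) x ++ wordSection n y F

/-- The section at `y` of the `j`-th power of a word. -/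
def powSection (n : ℕ) (F : List (Letter m GB)) (y : Fin (m + 2)) :
    ℕ → List (Letter m GB)
  | 0 => []
  | j + 1 => wordSection m ω n ((rootPerm m F ^ j) y) F ++ powSection n F y j

theorem evalWord_cons (n : ℕ) (x : Letter m GB) (F : List (Letter m GB)) :
    evalWord m ω n (x :: F) =
      Sum.elim (rootHom m) (levelHom m ω n) x * evalWord m ω n F := by
  simp [evalWord]

theorem evalWord_append (n : ℕ) (F F' : List (Letter m GB)) :
    evalWord m ω n (F ++ F') = evalWord m ω n F * evalWord m ω n F' := by
  simp [evalWord]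

theorem rootPerm_cons {β : Type*} (x : Letter m β) (F : List (Letter m β)) :
    rootPerm m (x :: F) = Sum.elim id (fun _ => 1) x * rootPerm m F := by
  simp [rootPerm]

theorem evalWord_nil_word (n : ℕ) (F : List (Letter m GB)) : evalWord m ω n F [] = [] := by
  induction F with
  | nil => rfl
  | cons x F ih =>
    rw [evalWord_cons, Equiv.Perm.mul_apply, ih]
    cases x <;> rfl

theorem letter_apply_cons (n : ℕ) (x : Letter m GB) (y : Fin (m + 2))
    (w : List (Fin (m + 2))) :
    Sum.elim (rootHom m) (levelHom m ω n) x (y :: w) =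
      (Sum.elim id (fun _ => 1) x : Equiv.Perm (Fin (m + 2))) y ::
        evalWord m ω (n + 1) (letterSection m ω n y x) w := by
  cases x with
  | inl a => rfl
  | inr b =>
    by_cases h₁ : y = qtop m
    · subst h₁
      simp [letterSection, evalWord, levelHom_qtop, (qone_ne_qtop m).symm]
    · by_cases h₂ : y = qone m
      · subst h₂
        simp [letterSection, evalWord, levelHom_qone, qone_ne_qtop m]
      · simp [letterSection, evalWord, levelHom_of_ne m ω n b h₁ h₂, h₁, h₂]

theorem evalWord_apply_cons (n : ℕ) (F : List (Letter m GB)) (y : Fin (m + 2))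
    (w : List (Fin (m + 2))) :
    evalWord m ω n F (y :: w) =
      rootPerm m F y :: evalWord m ω (n + 1) (wordSection m ω n y F) w := by
  induction F with
  | nil => rfl
  | cons x F ih =>
    rw [evalWord_cons, Equiv.Perm.mul_apply, ih, letter_apply_cons, rootPerm_cons,
      wordSection, evalWord_append]
    rfl

theorem evalWord_pow_apply_cons (n : ℕ) (F : List (Letter m GB)) (y : Fin (m + 2))
    (j : ℕ) (w : List (Fin (m + 2))) :
    (evalWord m ω n F ^ j) (y :: w) =
      (rootPerm m F ^ j) y :: evalWord m ω (n + 1) (powSection m ω n F y j) w := by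
  induction j with
  | zero => rfl
  | succ j ih =>
    rw [pow_succ', Equiv.Perm.mul_apply, ih, evalWord_apply_cons, powSection,
      evalWord_append, pow_succ']
    rfl

theorem evalWord_of_bLetters_eq_nil (n : ℕ) (F : List (Letter m GB)) (hF : bLetters F = []) :
    evalWord m ω n F = rootHom m (rootPerm m F) := by
  induction F with
  | nil => simp [evalWord, rootPerm]
  | cons x F ih =>
    cases x with
    | inl a =>
      rw [evalWord_cons, ih hF, rootPerm_cons, map_mul]
      rfl
    | inr b => exact absurd hF (List.cons_ne_nil b (bLetters F))

theorem bLetters_append {β : Type*} (F F' : List (Letter m β)) :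
    bLetters (F ++ F') = bLetters F ++ bLetters F' := List.filterMap_append

theorem aLetters_append {β : Type*} (F F' : List (Letter m β)) :
    aLetters (F ++ F') = aLetters F ++ aLetters F' := List.filterMap_append

theorem sum_bLetters_wordSection (n : ℕ) (F : List (Letter m GB)) :
    ∑ y, (bLetters (wordSection m ω n y F) : Multiset GB) = (bLetters F : Multiset GB) := by
  induction F with
  | nil => simp [wordSection, bLetters]
  | cons x F ih =>
    simp only [wordSection, bLetters_append, ← Multiset.coe_add, Finset.sum_add_distrib, ih]
    rw [Equiv.sum_comp (rootPerm m F)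
      (fun y => (bLetters (letterSection m ω n y x) : Multiset GB))]
    cases x with
    | inl a => simp [letterSection, bLetters]
    | inr b =>
      have h : ∀ y, (bLetters (letterSection m ω n y (Sum.inr b)) : Multiset GB) =
          if y = qtop m then {b} else 0 := by
        intro y
        simp only [letterSection, bLetters_append, ← Multiset.coe_add]
        split_ifs <;> simp [bLetters]
      simp only [h, Finset.sum_ite_eq', Finset.mem_univ, if_true]
      simp [bLetters]

theorem sum_aLetters_wordSection (n : ℕ) (F : List (Letter m GB)) :
    ∑ y, (aLetters (wordSection m ω n y F) : Multiset (Equiv.Perm (Fin (m + 2)))) =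
      (bLetters F : Multiset GB).map (ω n) := by
  induction F with
  | nil => simp [wordSection, aLetters, bLetters]
  | cons x F ih =>
    simp only [wordSection, aLetters_append, ← Multiset.coe_add, Finset.sum_add_distrib, ih]
    rw [Equiv.sum_comp (rootPerm m F)
      (fun y => (aLetters (letterSection m ω n y x) : Multiset (Equiv.Perm (Fin (m + 2)))))]
    cases x with
    | inl a => simp [letterSection, aLetters, bLetters]
    | inr b =>
      have h : ∀ y, (aLetters (letterSection m ω n y (Sum.inr b)) :
          Multiset (Equiv.Perm (Fin (m + 2)))) = if y = qone m then {ω n b} else 0 := by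
        intro y
        simp only [letterSection, aLetters_append, ← Multiset.coe_add]
        split_ifs <;> simp [aLetters]
      simp only [h, Finset.sum_ite_eq', Finset.mem_univ, if_true]
      simp [bLetters]

theorem bLetters_powSection (n : ℕ) (F : List (Letter m GB)) (y : Fin (m + 2)) (j : ℕ) :
    (bLetters (powSection m ω n F y j) : Multiset GB) =
      ∑ k ∈ Finset.range j,
        (bLetters (wordSection m ω n ((rootPerm m F ^ k) y) F) : Multiset GB) := by
  induction j with
  | zero => rfl
  | succ j ih =>
    rw [powSection, bLetters_append, ← Multiset.coe_add, ih, Finset.sum_range_succ, add_comm]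

theorem aLetters_powSection (n : ℕ) (F : List (Letter m GB)) (y : Fin (m + 2)) (j : ℕ) :
    (aLetters (powSection m ω n F y j) : Multiset (Equiv.Perm (Fin (m + 2)))) =
      ∑ k ∈ Finset.range j, (aLetters (wordSection m ω n ((rootPerm m F ^ k) y) F) :
        Multiset (Equiv.Perm (Fin (m + 2)))) := by
  induction j with
  | zero => rfl
  | succ j ih =>
    rw [powSection, aLetters_append, ← Multiset.coe_add, ih, Finset.sum_range_succ]
    exact add_comm _ _

end Action

/-- A sum along one cycle of a permutation is at most the sum over all points. -/
theorem sum_cycle_le {ι α : Type*} [Fintype ι] (σ : Equiv.Perm ι) (y : ι)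
    (f : ι → Multiset α) :
    ∑ k ∈ Finset.range (Function.minimalPeriod σ y), f ((σ ^ k) y) ≤ ∑ z, f z := by
  classical
  rw [← Finset.sum_image (s := Finset.range (Function.minimalPeriod σ y))
    (g := fun k => (σ ^ k) y) (f := f)]
  · exact Finset.sum_le_sum_of_subset (Finset.subset_univ _)
  · intro i hi j hj hij
    simp only [← Equiv.Perm.iterate_eq_pow] at hij
    exact Function.iterate_injOn_Iio_minimalPeriod (by simpa using hi) (by simpa using hj) hij

section Periodic

variable (m : ℕ) (ω : ℕ → GB →* Equiv.Perm (Fin (m + 2)))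

/-- The section of a word at the first return to the vertex `y`. -/
def returnSection (n : ℕ) (F : List (Letter m GB)) (y : Fin (m + 2)) : List (Letter m GB) :=
  powSection m ω n F y (Function.minimalPeriod (rootPerm m F) y)

theorem bLetters_returnSection_le (n : ℕ) (F : List (Letter m GB)) (y : Fin (m + 2)) :
    (bLetters (returnSection m ω n F y) : Multiset GB) ≤ bLetters F := by
  rw [returnSection, bLetters_powSection, ← sum_bLetters_wordSection m ω n F]
  exact sum_cycle_le (rootPerm m F) y
    (fun z => (bLetters (wordSection m ω n z F) : Multiset GB))

theorem aLetters_returnSection_le (n : ℕ) (F : List (Letter m GB)) (y : Fin (m + 2)) :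
    (aLetters (returnSection m ω n F y) : Multiset (Equiv.Perm (Fin (m + 2)))) ≤
      (bLetters F : Multiset GB).map (ω n) := by
  rw [returnSection, aLetters_powSection, ← sum_aLetters_wordSection m ω n F]
  exact sum_cycle_le (rootPerm m F) y
    (fun z => (aLetters (wordSection m ω n z F) : Multiset (Equiv.Perm (Fin (m + 2)))))

theorem isOfFinOrder_of_returnSection (n : ℕ) (F : List (Letter m GB))
    (h : ∀ y, IsOfFinOrder (evalWord m ω (n + 1) (returnSection m ω n F y))) :
    IsOfFinOrder (evalWord m ω n F) := by
  have key : ∀ y, ∃ N, 0 < N ∧ ∀ w, (evalWord m ω n F ^ N) (y :: w) = y :: w := by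
    intro y
    obtain ⟨k, hk, hk1⟩ := isOfFinOrder_iff_pow_eq_one.mp (h y)
    set p := Function.minimalPeriod (rootPerm m F) y with hp
    have hp0 : 0 < p :=
      Function.minimalPeriod_pos_of_mem_periodicPts
        ((Function.Injective.mem_periodicPts (rootPerm m F).injective) y)
    have hfix : (rootPerm m F ^ p) y = y := by
      rw [← Equiv.Perm.iterate_eq_pow]
      exact Function.iterate_minimalPeriod
    have step : ∀ j w, ((evalWord m ω n F ^ p) ^ j) (y :: w) =
        y :: (evalWord m ω (n + 1) (returnSection m ω n F y) ^ j) w := by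
      intro j
      induction j with
      | zero => intro w; rfl
      | succ j ih =>
        intro w
        rw [pow_succ', Equiv.Perm.mul_apply, ih, evalWord_pow_apply_cons, hfix, pow_succ']
        rfl
    refine ⟨p * k, Nat.mul_pos hp0 hk, fun w => ?_⟩
    rw [pow_mul, step, hk1, Equiv.Perm.one_apply]
  choose N hN hfix using key
  refine isOfFinOrder_iff_pow_eq_one.mpr ⟨∏ y, N y, Finset.prod_pos fun y _ => hN y, ?_⟩
  ext1 w
  cases w with
  | nil =>
    exact Equiv.Perm.pow_apply_eq_self_of_apply_eq_self (evalWord_nil_word m ω n F) _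
  | cons y w =>
    obtain ⟨c, hc⟩ := Finset.dvd_prod_of_mem N (Finset.mem_univ y)
    rw [hc, pow_mul]
    exact Equiv.Perm.pow_apply_eq_self_of_apply_eq_self (hfix y w) _

/-- The word `a₁ b₁ a₂ b₂ …` associated with a list of pairs. -/
def pairWord (ps : List (Equiv.Perm (Fin (m + 2)) × GB)) : List (Letter m GB) :=
  ps.flatMap fun p => [Sum.inl p.1, Sum.inr p.2]

theorem length_bLetters_pairWord {β : Type*} (ps : List (Equiv.Perm (Fin (m + 2)) × β)) :
    (bLetters (pairWord m ps)).length = ps.length := by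
  induction ps with
  | nil => rfl
  | cons p ps ih =>
    have h : bLetters (pairWord m (p :: ps)) = p.2 :: bLetters (pairWord m ps) := rfl
    simp [h, ih]

open scoped Classical in
theorem evalWord_eq_pairWord (n : ℕ) (F : List (Letter m GB)) :
    ∃ (ps : List (Equiv.Perm (Fin (m + 2)) × GB)) (b : GB),
      ps.length = (aLetters F).countP (· ≠ 1) ∧
      evalWord m ω n F = levelHom m ω n b * evalWord m ω n (pairWord m ps) := by
  induction F with
  | nil => exact ⟨[], 1, rfl, by simp [evalWord, pairWord]⟩
  | cons x F ih =>
    obtain ⟨ps, b, hlen, hev⟩ := ih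
    cases x with
    | inl a =>
      have hA : aLetters (Sum.inl a :: F) = a :: aLetters F := rfl
      by_cases ha : a = 1
      · refine ⟨ps, b, ?_, ?_⟩
        · rw [hA, List.countP_cons_of_neg (by simpa using ha), hlen]
        · rw [evalWord_cons, hev, ha]
          simp
      · refine ⟨(a, b) :: ps, 1, ?_, ?_⟩
        · simp [hA, ha, hlen]
        · rw [evalWord_cons, hev]
          simp [pairWord, evalWord]
    | inr c =>
      refine ⟨ps, c * b, hlen, ?_⟩
      rw [evalWord_cons, hev, map_mul, mul_assoc]
      rfl

variable [Finite GB]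

theorem isOfFinOrder_levelHom (n : ℕ) (b : GB) : IsOfFinOrder (levelHom m ω n b) :=
  (levelHom m ω n).isOfFinOrder (isOfFinOrder_of_finite b)

open scoped Classical in
theorem isOfFinOrder_of_countP_lt (n k : ℕ)
    (ih : ∀ F : List (Letter m GB), (bLetters F).length < k → IsOfFinOrder (evalWord m ω n F))
    (F : List (Letter m GB)) (hF : (aLetters F).countP (· ≠ 1) < k) :
    IsOfFinOrder (evalWord m ω n F) := by
  obtain ⟨ps, b, hlen, hev⟩ := evalWord_eq_pairWord m ω n F
  rcases List.eq_nil_or_concat ps with rfl | ⟨ps', p, rfl⟩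
  · rw [hev]
    simpa [pairWord, evalWord] using isOfFinOrder_levelHom m ω n b
  · have hconj : IsConj (evalWord m ω n (pairWord m (ps' ++ [(p.1, p.2 * b)])))
        (evalWord m ω n F) := by
      rw [isConj_iff]
      refine ⟨levelHom m ω n b, ?_⟩
      rw [hev]
      simp [pairWord, evalWord, mul_assoc]
    refine (isConj_iff.mp hconj).elim fun c hc => ?_
    rw [← hc, ← MulAut.conj_apply]
    refine (MulAut.conj c).toMonoidHom.isOfFinOrder (ih _ ?_)
    rw [length_bLetters_pairWord]
    rw [List.length_concat] at hlen
    rw [List.length_append, List.length_singleton]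
    omega

/-- Spinal groups are periodic as soon as the kernels of every tail of `ω` cover `G_B`. -/
theorem isOfFinOrder_evalWord (hcover : ∀ i : ℕ, ∀ b : GB, ∃ j, i ≤ j ∧ ω j b = 1)
    (n : ℕ) (F : List (Letter m GB)) : IsOfFinOrder (evalWord m ω n F) := by
  classical
  induction hk : (bLetters F).length using Nat.strong_induction_on generalizing n F with
  | _ k ih =>
    rcases List.eq_nil_or_concat (bLetters F) with h0 | ⟨l, b, hb⟩
    · rw [evalWord_of_bLetters_eq_nil m ω n F h0]
      exact (rootHom m).isOfFinOrder (isOfFinOrder_of_finite _)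
    · have hmem : b ∈ bLetters F := by simp [hb]
      obtain ⟨j, hj, hjb⟩ := hcover n b
      obtain ⟨t, rfl⟩ := Nat.exists_eq_add_of_le hj
      clear hb hj
      induction t generalizing n F with
      | zero =>
        refine isOfFinOrder_of_returnSection m ω n F fun y => ?_
        refine isOfFinOrder_of_countP_lt m ω (n + 1) k (fun F' hF' => ih _ hF' _ _ rfl) _ ?_
        have h1 := Multiset.countP_le_of_le (· ≠ 1) (aLetters_returnSection_le m ω n F y)
        obtain ⟨s, hs⟩ := Multiset.exists_cons_of_mem (Multiset.mem_coe.mpr hmem)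
        have h2 : s.card + 1 = k := by
          rw [← hk, ← Multiset.coe_card, hs, Multiset.card_cons]
        rw [hs, Multiset.map_cons, Multiset.countP_cons_of_neg _ (by simpa using hjb),
          Multiset.coe_countP] at h1
        have h3 := Multiset.countP_le_card (· ≠ 1) (s.map (ω n))
        rw [Multiset.card_map] at h3
        omega
      | succ t iht =>
        refine isOfFinOrder_of_returnSection m ω n F fun y => ?_
        have hle := bLetters_returnSection_le m ω n F y
        have hcard := Multiset.card_le_card hle
        simp only [Multiset.coe_card] at hcard
        rcases Nat.lt_or_ge (bLetters (returnSection m ω n F y)).length k with hlt | hge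
        · exact ih _ hlt _ _ rfl
        · have heq := Multiset.eq_of_le_of_card_le hle (by simpa [hk] using hge)
          refine iht (n + 1) _ (by omega) ?_ ?_
          · rwa [← Multiset.mem_coe, heq, Multiset.mem_coe]
          · rwa [show n + 1 + t = n + (t + 1) by omega]

end Periodic

/-- If `g` fixes a vertex of the first level with section `h`, the order of `h` divides the
order of `g`. -/
theorem orderOf_dvd_of_section {α : Type*} {g h : Equiv.Perm (List α)} (y : α)
    (hg : ∀ w, g (y :: w) = y :: h w) : orderOf h ∣ orderOf g := by
  have hpow : ∀ j w, (g ^ j) (y :: w) = y :: (h ^ j) w := by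
    intro j
    induction j with
    | zero => intro w; rfl
    | succ j ih =>
      intro w
      rw [pow_succ', Equiv.Perm.mul_apply, ih, hg, pow_succ']
      rfl
  refine orderOf_dvd_of_pow_eq_one (Equiv.ext fun w => ?_)
  have h1 := hpow (orderOf g) w
  rw [pow_orderOf_eq_one] at h1
  exact (List.cons.inj h1).2.symm

/-- If `g` moves a vertex of the first level fixed by `g * g`, and the section of `g * g`
there is `h`, then twice the order of `h` divides the order of `g`. -/
theorem two_mul_orderOf_dvd_of_section {α : Type*} {g h : Equiv.Perm (List α)} {y z : α}
    (hyz : z ≠ y) {u : List α → List α} (hg : ∀ w, g (y :: w) = z :: u w)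
    (hgg : ∀ w, (g * g) (y :: w) = y :: h w) : 2 * orderOf h ∣ orderOf g := by
  have hpow : ∀ j w, ((g * g) ^ j) (y :: w) = y :: (h ^ j) w := by
    intro j
    induction j with
    | zero => intro w; rfl
    | succ j ih =>
      intro w
      rw [pow_succ', Equiv.Perm.mul_apply, ih, hgg, pow_succ']
      rfl
  have h1 := pow_orderOf_eq_one g
  rcases Nat.even_or_odd' (orderOf g) with ⟨j, hj | hj⟩
  · rw [hj]
    refine Nat.mul_dvd_mul_left 2 (orderOf_dvd_of_pow_eq_one (Equiv.ext fun w => ?_))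
    rw [hj, pow_mul, pow_two] at h1
    have h2 := hpow j w
    rw [h1] at h2
    exact (List.cons.inj h2).2.symm
  · exfalso
    rw [hj, pow_succ', pow_mul, pow_two] at h1
    have h2 := congrArg (fun f : Equiv.Perm (List α) => f [y]) h1
    simp only [Equiv.Perm.mul_apply g] at h2
    rw [hpow, hg] at h2
    exact hyz (List.cons.inj h2).1

section Lifting

variable (m : ℕ) (ω : ℕ → GB →* Equiv.Perm (Fin (m + 2))) (a : Equiv.Perm (Fin (m + 2)))

/-- The element `a b₁ a b₂ … a b_k`, for the sequence `ω` shifted by `n`. -/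
def altElem (n : ℕ) (l : List GB) : Equiv.Perm (List (Fin (m + 2))) :=
  (l.map fun b => rootHom m a * levelHom m ω n b).prod

/-- The element `b₁ a b₂ a … b_k a`, for the sequence `ω` shifted by `n`. -/
def altElem' (n : ℕ) (l : List GB) : Equiv.Perm (List (Fin (m + 2))) :=
  (l.map fun b => levelHom m ω n b * rootHom m a).prod

/-- The list `x₁, y₁, x₂, y₂, …` associated with a list of pairs `(xᵢ, yᵢ)`. -/
def flattenPairs {β : Type*} (zs : List (β × β)) : List β :=
  zs.flatMap fun z => [z.1, z.2]

theorem flattenPairs_cons {β : Type*} (z : β × β) (zs : List (β × β)) :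
    flattenPairs (z :: zs) = z.1 :: z.2 :: flattenPairs zs := rfl

theorem flattenPairs_append {β : Type*} (zs zs' : List (β × β)) :
    flattenPairs (zs ++ zs') = flattenPairs zs ++ flattenPairs zs' := List.flatMap_append

theorem length_flattenPairs {β : Type*} (zs : List (β × β)) :
    (flattenPairs zs).length = 2 * zs.length := by
  induction zs with
  | nil => rfl
  | cons z zs ih =>
    rw [flattenPairs_cons]
    simp [ih]
    ring

theorem mem_flattenPairs {β : Type*} {zs : List (β × β)} {x : β} :
    x ∈ flattenPairs zs ↔ ∃ z ∈ zs, x = z.1 ∨ x = z.2 := by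
  simp [flattenPairs]

theorem altElem_cons (n : ℕ) (b : GB) (l : List GB) :
    altElem m ω a n (b :: l) = rootHom m a * levelHom m ω n b * altElem m ω a n l := by
  simp [altElem]

theorem altElem_singleton (n : ℕ) (b : GB) :
    altElem m ω a n [b] = rootHom m a * levelHom m ω n b := by
  simp [altElem]

theorem altElem_append (n : ℕ) (l l' : List GB) :
    altElem m ω a n (l ++ l') = altElem m ω a n l * altElem m ω a n l' := by
  simp [altElem]

theorem altElem'_cons (n : ℕ) (b : GB) (l : List GB) :
    altElem' m ω a n (b :: l) = levelHom m ω n b * rootHom m a * altElem' m ω a n l := by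
  simp [altElem']

theorem rootHom_mul_altElem' (n : ℕ) (l : List GB) :
    rootHom m a * altElem' m ω a n l = altElem m ω a n l * rootHom m a := by
  induction l with
  | nil => simp [altElem, altElem']
  | cons b l ih =>
    rw [altElem'_cons, altElem_cons, mul_assoc (rootHom m a * levelHom m ω n b), ← ih]
    simp only [mul_assoc]

theorem altElem_flattenPairs_qtop (h₁ : a (qone m) = qtop m) (h₂ : a (qtop m) = qone m)
    (n : ℕ) (zs : List (GB × GB)) (hzs : ∀ z ∈ zs, ω n z.1 = a)
    (w : List (Fin (m + 2))) :
    altElem m ω a n (flattenPairs zs) (qtop m :: w) =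
      qtop m :: altElem m ω a (n + 1) (zs.map Prod.snd) w := by
  induction zs with
  | nil => rfl
  | cons z zs ih =>
    rw [flattenPairs_cons, altElem_cons, altElem_cons, List.map_cons, altElem_cons]
    simp only [Equiv.Perm.mul_apply]
    rw [ih fun z hz => hzs z (List.mem_cons_of_mem _ hz)]
    simp only [levelHom_qtop, levelHom_qone, rootHom_cons, h₁, h₂, hzs z List.mem_cons_self]

theorem altElem_flattenPairs_qone (h₁ : a (qone m) = qtop m) (h₂ : a (qtop m) = qone m)
    (n : ℕ) (zs : List (GB × GB)) (hzs : ∀ z ∈ zs, ω n z.2 = a)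
    (w : List (Fin (m + 2))) :
    altElem m ω a n (flattenPairs zs) (qone m :: w) =
      qone m :: altElem' m ω a (n + 1) (zs.map Prod.fst) w := by
  induction zs with
  | nil => rfl
  | cons z zs ih =>
    rw [flattenPairs_cons, altElem_cons, altElem_cons, List.map_cons, altElem'_cons]
    simp only [Equiv.Perm.mul_apply]
    rw [ih fun z hz => hzs z (List.mem_cons_of_mem _ hz)]
    simp only [levelHom_qtop, levelHom_qone, rootHom_cons, h₁, h₂, hzs z List.mem_cons_self]

/-- Lifting a word through one level, doubling its length, does not lose order. -/
theorem orderOf_altElem_dvd_flattenPairs (h₁ : a (qone m) = qtop m)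
    (h₂ : a (qtop m) = qone m) (n : ℕ) (zs : List (GB × GB))
    (hzs : ∀ z ∈ zs, ω n z.1 = a) :
    orderOf (altElem m ω a (n + 1) (zs.map Prod.snd)) ∣
      orderOf (altElem m ω a n (flattenPairs zs)) :=
  orderOf_dvd_of_section (qtop m) (altElem_flattenPairs_qtop m ω a h₁ h₂ n zs hzs)

/-- Lifting a word with two antipodal letters in the kernel doubles its order. -/
theorem two_mul_orderOf_altElem_dvd (h₁ : a (qone m) = qtop m) (h₂ : a (qtop m) = qone m)
    (n : ℕ) (zs : List (GB × GB))
    (hzs : ∀ z ∈ zs, ω n z.1 = a ∧ ω n z.2 = a) (e e' d : GB) (he : ω n e = a)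
    (he' : ω n e' = a) (hd : ω n d = 1) :
    2 * orderOf (altElem m ω a (n + 1)
        (zs.map Prod.fst ++ [e * e'] ++ zs.map Prod.snd ++ [d])) ∣
      orderOf (altElem m ω a n ([e'] ++ flattenPairs zs ++ [e] ++ [d])) := by
  have hq : ∀ w, altElem m ω a n ([e'] ++ flattenPairs zs ++ [e] ++ [d]) (qtop m :: w) =
      qone m :: (levelHom m ω (n + 1) e' * altElem m ω a (n + 1) (zs.map Prod.snd) *
        rootHom m a * levelHom m ω (n + 1) d) w := by
    intro w
    simp only [altElem_append, altElem_singleton, Equiv.Perm.mul_apply, levelHom_qtop, levelHom_qone,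
      rootHom_cons, h₁, h₂, he]
    rw [altElem_flattenPairs_qtop m ω a h₁ h₂ n zs fun z hz => (hzs z hz).1]
    simp only [levelHom_qtop, rootHom_cons, h₂]
  have h1 : ∀ w, altElem m ω a n ([e'] ++ flattenPairs zs ++ [e] ++ [d]) (qone m :: w) =
      qtop m :: (rootHom m a * altElem' m ω a (n + 1) (zs.map Prod.fst) *
        levelHom m ω (n + 1) e) w := by
    intro w
    simp only [altElem_append, altElem_singleton, Equiv.Perm.mul_apply, levelHom_qtop, levelHom_qone,
      rootHom_cons, h₁, h₂, hd, map_one, Equiv.Perm.one_apply]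
    rw [altElem_flattenPairs_qone m ω a h₁ h₂ n zs fun z hz => (hzs z hz).2]
    simp only [levelHom_qone, rootHom_cons, h₁, he']
  refine two_mul_orderOf_dvd_of_section (qone_ne_qtop m) hq fun w => ?_
  rw [Equiv.Perm.mul_apply, hq, h1, rootHom_mul_altElem']
  simp only [altElem_append, altElem_singleton, map_mul, ← Equiv.Perm.mul_apply, mul_assoc]

end Lifting

section Construction

variable (m : ℕ) (ω : ℕ → GB →* Equiv.Perm (Fin (m + 2))) (a : Equiv.Perm (Fin (m + 2)))

/-- There is a word at level `n` of the form `a y₁ … a y_{2k} a d` with `ω 0 yᵢ = a` and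
`ω 0 d = 1`, whose order is a multiple of `N`. -/
def HasOddWord (n N k : ℕ) : Prop :=
  ∃ (ys : List GB) (d : GB), ys.length = 2 * k ∧ (∀ y ∈ ys, ω 0 y = a) ∧ ω 0 d = 1 ∧
    N ∣ orderOf (altElem m ω a n (ys ++ [d]))

/-- There is a word at level `n` of even length `2p + 2`, with two antipodal letters in the
kernel of `ω 0` and all other letters sent to `a` by `ω 0`, whose order is a multiple
of `N`. -/
def HasEvenWord (n N p : ℕ) : Prop :=
  ∃ (ps qs : List GB) (c d : GB), ps.length = p ∧ qs.length = p ∧ (∀ y ∈ ps, ω 0 y = a) ∧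
    (∀ y ∈ qs, ω 0 y = a) ∧ ω 0 c = 1 ∧ ω 0 d = 1 ∧
    N ∣ orderOf (altElem m ω a n (ps ++ [c] ++ qs ++ [d]))

variable {m ω a}

theorem exists_pairs_shift {β : Type*} (c₀ c d : β) (ys : List β) :
    ∃ zs : List (β × β), flattenPairs zs = c₀ :: (ys.flatMap (fun y => [y, c]) ++ [d]) ∧
      zs.map Prod.snd = ys ++ [d] ∧ ∀ z ∈ zs, z.1 = c₀ ∨ z.1 = c := by
  induction ys generalizing c₀ with
  | nil => exact ⟨[(c₀, d)], rfl, rfl, by simp⟩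
  | cons y ys ih =>
    obtain ⟨zs, h1, h2, h3⟩ := ih c
    refine ⟨(c₀, y) :: zs, ?_, ?_, ?_⟩
    · rw [flattenPairs_cons, h1]
      rfl
    · rw [List.map_cons, h2]
      rfl
    · intro z hz
      rcases List.mem_cons.mp hz with rfl | hz
      · exact Or.inl rfl
      · rcases h3 z hz with h | h <;> exact Or.inr h

theorem HasOddWord.toEven (h₁ : a (qone m) = qtop m) (h₂ : a (qtop m) = qone m) {n N k : ℕ}
    (h : HasOddWord m ω a (n + 1) N k) {c c₀ : GB} (hc : ω n c = a) (hc' : ω 0 c = a)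
    (hc₀ : ω n c₀ = a) (hc₀' : ω 0 c₀ = 1) : HasEvenWord m ω a n N (2 * k) := by
  obtain ⟨ys, d, hlen, hys, hd, hN⟩ := h
  obtain ⟨zs, hz1, hz2, hz3⟩ := exists_pairs_shift c₀ c d (ys.drop k)
  have hsplit := List.take_append_drop k ys
  have hl1 : (ys.take k).length = k := by
    rw [List.length_take]
    omega
  have hl2 : (ys.drop k).length = k := by
    rw [List.length_drop]
    omega
  refine ⟨flattenPairs ((ys.take k).map fun y => (c, y)), (ys.drop k).flatMap fun y => [y, c],
    c₀, d, ?_, ?_, ?_, ?_, hc₀', hd, hN.trans ?_⟩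
  · rw [length_flattenPairs, List.length_map, hl1]
  · simp [List.length_flatMap]
    omega
  · intro y hy
    obtain ⟨z, hz, hyz⟩ := mem_flattenPairs.mp hy
    obtain ⟨x, hx, rfl⟩ := List.mem_map.mp hz
    rcases hyz with rfl | rfl
    · exact hc'
    · exact hys _ (List.mem_of_mem_take hx)
  · intro y hy
    obtain ⟨x, hx, hyx⟩ := List.mem_flatMap.mp hy
    simp only [List.mem_cons, List.not_mem_nil, or_false] at hyx
    rcases hyx with rfl | rfl
    · exact hys _ (List.mem_of_mem_drop hx)
    · exact hc'
  · have hdvd := orderOf_altElem_dvd_flattenPairs m ω a h₁ h₂ n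
      (((ys.take k).map fun y => (c, y)) ++ zs) (by
        intro z hz
        rcases List.mem_append.mp hz with hz | hz
        · obtain ⟨x, -, rfl⟩ := List.mem_map.mp hz
          exact hc
        · rcases hz3 z hz with h | h <;> rw [h] <;> assumption)
    have hs : (((ys.take k).map fun y => (c, y)) ++ zs).map Prod.snd = ys ++ [d] := by
      rw [List.map_append, hz2, List.map_map, ← List.append_assoc]
      conv_rhs => rw [← hsplit]
      congr 2
      exact List.map_id _
    rw [hs, flattenPairs_append, hz1] at hdvd
    simpa using hdvd

theorem HasEvenWord.lift (h₁ : a (qone m) = qtop m) (h₂ : a (qtop m) = qone m) {n N p : ℕ}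
    (h : HasEvenWord m ω a (n + 1) N p) {c : GB} (hc : ω n c = a) (hc' : ω 0 c = a) :
    HasEvenWord m ω a n N (2 * p + 1) := by
  obtain ⟨ps, qs, c₀, d, hps, hqs, hps', hqs', hc₀, hd, hN⟩ := h
  have hmem : ∀ l : List GB, (∀ y ∈ l, ω 0 y = a) →
      ∀ y ∈ flattenPairs (l.map fun y => (c, y)) ++ [c], ω 0 y = a := by
    intro l hl y hy
    rcases List.mem_append.mp hy with hy | hy
    · obtain ⟨z, hz, hyz⟩ := mem_flattenPairs.mp hy
      obtain ⟨x, hx, rfl⟩ := List.mem_map.mp hz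
      rcases hyz with rfl | rfl
      · exact hc'
      · exact hl _ hx
    · rw [List.mem_singleton.mp hy, hc']
  refine ⟨flattenPairs (ps.map fun y => (c, y)) ++ [c],
    flattenPairs (qs.map fun y => (c, y)) ++ [c], c₀, d, ?_, ?_, hmem ps hps', hmem qs hqs',
    hc₀, hd, hN.trans ?_⟩
  · simp [length_flattenPairs, hps]
  · simp [length_flattenPairs, hqs]
  · have hdvd := orderOf_altElem_dvd_flattenPairs m ω a h₁ h₂ n
      ((ps ++ [c₀] ++ qs ++ [d]).map fun y => (c, y)) (by
        intro z hz
        obtain ⟨x, -, rfl⟩ := List.mem_map.mp hz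
        exact hc)
    rw [List.map_map, show (Prod.snd ∘ fun y : GB => (c, y)) = id from rfl, List.map_id]
      at hdvd
    simpa [flattenPairs_append, flattenPairs_cons, flattenPairs] using hdvd

theorem HasEvenWord.toOdd (h₁ : a (qone m) = qtop m) (h₂ : a (qtop m) = qone m)
    (ha : a * a = 1) {n N p : ℕ} (h : HasEvenWord m ω a (n + 1) N p) (hn : ω 0 = ω n)
    {e : GB} (he : ω 0 e = a) : HasOddWord m ω a n (2 * N) (p + 1) := by
  obtain ⟨ps, qs, c, d, hps, hqs, hps', hqs', hc, hd, hN⟩ := h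
  have he' : ω 0 (e⁻¹ * c) = a := by
    rw [map_mul, map_inv, he, hc, mul_one, inv_eq_of_mul_eq_one_right ha]
  have hz : ∀ z ∈ ps.zip qs, ω 0 z.1 = a ∧ ω 0 z.2 = a := fun z hz =>
    ⟨hps' _ (List.of_mem_zip hz).1, hqs' _ (List.of_mem_zip hz).2⟩
  refine ⟨[e⁻¹ * c] ++ flattenPairs (ps.zip qs) ++ [e], d, ?_, ?_, hd, ?_⟩
  · simp [length_flattenPairs, hps, hqs]
    ring
  · intro y hy
    rcases List.mem_append.mp hy with hy | hy
    · rcases List.mem_append.mp hy with hy | hy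
      · rw [List.mem_singleton.mp hy, he']
      · obtain ⟨z, hzm, rfl | rfl⟩ := mem_flattenPairs.mp hy
        · exact (hz z hzm).1
        · exact (hz z hzm).2
    · rw [List.mem_singleton.mp hy, he]
  · have hdvd := two_mul_orderOf_altElem_dvd m ω a h₁ h₂ n (ps.zip qs)
      (by rwa [← hn]) e (e⁻¹ * c) d (by rwa [← hn]) (by rwa [← hn]) (by rwa [← hn])
    rw [List.map_fst_zip (by omega), List.map_snd_zip (by omega), mul_inv_cancel_left] at hdvd
    exact (Nat.mul_dvd_mul_left 2 hN).trans hdvd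

theorem HasEvenWord.lift_iterate (h₁ : a (qone m) = qtop m) (h₂ : a (qtop m) = qone m)
    {n N p : ℕ} (t : ℕ) (h : HasEvenWord m ω a (n + t) N p)
    (hc : ∀ j, n ≤ j → ∃ c : GB, ω 0 c = a ∧ ω j c = a) :
    ∃ p', p' + 1 = (p + 1) * 2 ^ t ∧ HasEvenWord m ω a n N p' := by
  induction t generalizing p with
  | zero => exact ⟨p, by simp, h⟩
  | succ t ih =>
    obtain ⟨c, hc0, hct⟩ := hc (n + t) (Nat.le_add_right n t)
    obtain ⟨p', hp', hw⟩ := ih (h.lift h₁ h₂ hct hc0)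
    exact ⟨p', by rw [hp', pow_succ]; ring, hw⟩

/-- Odd words of order divisible by `2 ^ K` and of length at most a constant times
`2 ^ ((r - 1) * K)`, at every level in `I`. -/
theorem exists_hasOddWord (h₁ : a (qone m) = qtop m) (h₂ : a (qtop m) = qone m)
    (ha : a * a = 1) {r : ℕ} {I : Set ℕ}
    (hI : I = {0} ∪ {i : ℕ | 0 < i ∧ ω 0 = ω i ∧ ω (i - 1) ≠ ω i})
    (hgap : ∀ i ∈ I, ∃ j ∈ I, i < j ∧ j ≤ i + r)
    (hK1 : ∀ j : ℕ, 0 < j → ∃ b : GB, ω 0 b = a ∧ ω j b = a)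
    (hK2 : ∀ i ∈ I, 0 < i → ∃ b : GB, ω 0 b = 1 ∧ ω (i - 1) b = a) (K : ℕ) :
    ∀ i ∈ I, ∃ k, k + 1 ≤ (2 ^ (r - 1)) ^ K ∧ HasOddWord m ω a i (2 ^ K) k := by
  have hI0 : ∀ i ∈ I, ω 0 = ω i := by
    intro i hi
    rw [hI] at hi
    rcases hi with rfl | hi
    · rfl
    · exact hi.2.1
  induction K with
  | zero => exact fun i _ => ⟨0, by simp, [], 1, rfl, by simp, map_one _, by simp⟩
  | succ K ih =>
    intro i hi
    obtain ⟨j, hj, hij, hjr⟩ := hgap i hi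
    obtain ⟨k, hk, hodd⟩ := ih j hj
    have hj0 : 0 < j := by omega
    have hne : ω (j - 1) ≠ ω j := by
      have hj' := hj
      rw [hI] at hj'
      rcases hj' with h | h
      · exact absurd h hj0.ne'
      · exact h.2.2
    have hij' : i + 1 < j := by
      rcases Nat.lt_or_ge (i + 1) j with h | h
      · exact h
      · exfalso
        apply hne
        rw [show j - 1 = i by omega, ← hI0 i hi, hI0 j hj]
    obtain ⟨t, rfl⟩ := Nat.exists_eq_add_of_lt hij'
    obtain ⟨c₀, hc₀, hc₀'⟩ := hK2 _ hj hj0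
    rw [Nat.add_sub_cancel] at hc₀'
    obtain ⟨c, hc, hc'⟩ := hK1 (i + 1 + t) (by omega)
    obtain ⟨p, hp, hev⟩ := (hodd.toEven h₁ h₂ hc' hc hc₀' hc₀).lift_iterate h₁ h₂ t
      fun j hj => hK1 j (by omega)
    refine ⟨p + 1, ?_, ?_⟩
    · have h2 : 1 ≤ 2 ^ t := Nat.one_le_two_pow
      calc p + 1 + 1 = (2 * k + 1) * 2 ^ t + 1 := by rw [hp]
        _ ≤ (k + 1) * 2 ^ (t + 1) := by
          rw [pow_succ]
          nlinarith
        _ ≤ (2 ^ (r - 1)) ^ K * 2 ^ (r - 1) :=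
          Nat.mul_le_mul hk (Nat.pow_le_pow_right two_pos (by omega))
        _ = _ := (pow_succ _ _).symm
    · rw [pow_succ']
      exact hev.toOdd h₁ h₂ ha (hI0 i hi) hc

end Construction

section WordLength

/-- A product of `n` elements of `S ∪ {1}` has word length at most `n`. -/
theorem wordLength_prod_le {G : Type*} [Group G] (S : Set G) (l : List G)
    (hl : ∀ x ∈ l, x = 1 ∨ x ∈ S) : wordLength S l.prod ≤ l.length := by
  have key : ∃ l' : List G, l'.length ≤ l.length ∧ (∀ x ∈ l', x ∈ S) ∧ l'.prod = l.prod := by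
    induction l with
    | nil => exact ⟨[], le_rfl, by simp, rfl⟩
    | cons x l ih =>
      obtain ⟨l', h1, h2, h3⟩ := ih fun y hy => hl y (List.mem_cons_of_mem _ hy)
      rcases hl x List.mem_cons_self with rfl | hx
      · exact ⟨l', by simp; omega, h2, by simp [h3]⟩
      · refine ⟨x :: l', by simpa using h1, ?_, by simp [h3]⟩
        intro y hy
        rcases List.mem_cons.mp hy with rfl | hy
        · exact hx
        · exact h2 y hy
  obtain ⟨l', h1, h2, h3⟩ := key
  have h4 : wordLength S l.prod ≤ l'.length := Nat.sInf_le ⟨l', rfl, h2, h3⟩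
  exact h4.trans h1

theorem finite_wordLength_le {G : Type*} [Group G] (S : Set G) (hS : S.Finite)
    (hinv : ∀ x ∈ S, x⁻¹ ∈ S) (n : ℕ) :
    {g : G | g ∈ Subgroup.closure S ∧ wordLength S g ≤ n}.Finite := by
  have : Finite S := hS
  refine ((List.finite_length_le S n).image fun l => (l.map Subtype.val).prod).subset ?_
  rintro g ⟨hg, hn⟩
  have hne : {n | ∃ l : List G, l.length = n ∧ (∀ x ∈ l, x ∈ S) ∧ l.prod = g}.Nonempty := by
    rw [← Subgroup.mem_toSubmonoid, Subgroup.closure_toSubmonoid] at hg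
    obtain ⟨l, hl, hlg⟩ := Submonoid.exists_list_of_mem_closure hg
    refine ⟨l.length, l, rfl, fun x hx => ?_, hlg⟩
    rcases hl x hx with h | h
    · exact h
    · simpa using hinv _ h
  obtain ⟨l, hl, hlS, hlg⟩ := Nat.sInf_mem hne
  refine ⟨l.attachWith (· ∈ S) hlS, ?_, ?_⟩
  · rw [Set.mem_ofPred_eq, List.length_attachWith, hl]
    exact hn
  · simpa using hlg

variable (m : ℕ) (GA : Subgroup (Equiv.Perm (Fin (m + 2))))
  (ω : ℕ → GB →* Equiv.Perm (Fin (m + 2)))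

theorem finite_genSet [Finite GB] : (genSet m GA ω).Finite :=
  ((Set.toFinite _).union (Set.finite_range _)).subset Set.sdiff_subset

theorem inv_mem_genSet {x : Equiv.Perm (List (Fin (m + 2)))} (hx : x ∈ genSet m GA ω) :
    x⁻¹ ∈ genSet m GA ω := by
  obtain ⟨hx, hx1⟩ := hx
  refine ⟨?_, by simpa using hx1⟩
  rcases hx with ⟨a, ha, rfl⟩ | ⟨b, rfl⟩
  · exact Or.inl ⟨a⁻¹, GA.inv_mem ha, map_inv (rootHom m) a⟩
  · exact Or.inr ⟨b⁻¹, map_inv (levelHom m ω 0) b⟩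

theorem orderOf_le_periodGrowth [Finite GB] {g : Equiv.Perm (List (Fin (m + 2)))} {n : ℕ}
    (hg : g ∈ spinalGroup m GA ω) (hn : wordLength (genSet m GA ω) g ≤ n) :
    orderOf g ≤ periodGrowth m GA ω n :=
  le_csSup (((finite_wordLength_le _ (finite_genSet m GA ω)
    (fun _ hx => inv_mem_genSet m GA ω hx) n).image _).bddAbove) ⟨g, ⟨hg, hn⟩, rfl⟩

theorem one_le_periodGrowth [Finite GB] (n : ℕ) : 1 ≤ periodGrowth m GA ω n := by
  have h := wordLength_prod_le (genSet m GA ω) [] (by simp)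
  have h' := orderOf_le_periodGrowth m GA ω (Subgroup.one_mem _) (h.trans (Nat.zero_le n))
  rwa [orderOf_one] at h'

theorem altElem_mem_and_wordLength_le {a : Equiv.Perm (Fin (m + 2))} (ha : a ∈ GA)
    (l : List GB) : altElem m ω a 0 l ∈ spinalGroup m GA ω ∧
      wordLength (genSet m GA ω) (altElem m ω a 0 l) ≤ 2 * l.length := by
  have hprod : altElem m ω a 0 l =
      (l.flatMap fun b => [rootHom m a, levelHom m ω 0 b]).prod := by
    induction l with
    | nil => rfl
    | cons b l ih =>
      rw [altElem_cons, ih]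
      simp [mul_assoc]
  have hmem : ∀ x ∈ l.flatMap fun b => [rootHom m a, levelHom m ω 0 b],
      x = 1 ∨ x ∈ genSet m GA ω := by
    intro x hx
    rw [or_iff_not_imp_left]
    intro hx1
    obtain ⟨b, -, hb⟩ := List.mem_flatMap.mp hx
    simp only [List.mem_cons, List.not_mem_nil, or_false] at hb
    refine ⟨?_, hx1⟩
    rcases hb with rfl | rfl
    · exact Or.inl ⟨a, ha, rfl⟩
    · exact Or.inr ⟨b, rfl⟩
  rw [hprod]
  constructor
  · refine Subgroup.list_prod_mem _ fun x hx => ?_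
    rcases hmem x hx with rfl | h
    · exact Subgroup.one_mem _
    · exact Subgroup.subset_closure h
  · refine (wordLength_prod_le _ _ hmem).trans (le_of_eq ?_)
    simp [List.length_flatMap, mul_comm]

theorem altElem_eq_evalWord (a : Equiv.Perm (Fin (m + 2))) (n : ℕ) (l : List GB) :
    altElem m ω a n l = evalWord m ω n (pairWord m (l.map fun b => (a, b))) := by
  induction l with
  | nil => rfl
  | cons b l ih =>
    rw [altElem_cons, ih]
    simp [pairWord, evalWord, mul_assoc]

end WordLength

/-- Lower bound on period growth: suppose the action of `G_A` is regular, `a ∈ G_A` has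
order 2 and maps `1` to `q`, and with `K_{j,a} = {b : ω_j(b) = a}` and
`I = {1} ∪ {i > 1 : ω₁ = ω_i, ω_{i−1} ≠ ω_i}` (0-based here), assume: `I` is infinite,
consecutive indices of `I` differ by at most `r`, `K_{1,a} ∩ K_{j,a} ≠ ∅` for all `j > 1`
and `K₁ ∩ K_{j−1,a} ≠ ∅` for all `j ∈ I`, `j > 1`. Then `n^{1/(r−1)} ≾ π_ω(n)`. -/
theorem spinalGroup_period_growth_lower_bound (m : ℕ)
    (GA : Subgroup (Equiv.Perm (Fin (m + 2))))
    {GB : Type*} [Group GB] [Finite GB] (ω : ℕ → GB →* Equiv.Perm (Fin (m + 2)))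
    (hdata : SpinalData m GA ω)
    (hreg : ∀ a ∈ GA, ∀ y z : Fin (m + 2),
      Function.minimalPeriod (⇑a) y = Function.minimalPeriod (⇑a) z)
    (r : ℕ) (a : Equiv.Perm (Fin (m + 2))) (ha : a ∈ GA)
    (ha2 : orderOf a = 2) (haq : a (qone m) = qtop m)
    (I : Set ℕ) (hI : I = {0} ∪ {i : ℕ | 0 < i ∧ ω 0 = ω i ∧ ω (i - 1) ≠ ω i})
    (hIinf : I.Infinite)
    (hgap : ∀ i ∈ I, ∃ j ∈ I, i < j ∧ j ≤ i + r)
    (hK1 : ∀ j : ℕ, 0 < j → ∃ b : GB, ω 0 b = a ∧ ω j b = a)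
    (hK2 : ∀ i ∈ I, 0 < i → ∃ b : GB, ω 0 b = 1 ∧ ω (i - 1) b = a) :
    ∃ C : ℝ, 0 < C ∧ ∀ x : ℝ, 0 ≤ x →
      x ^ ((1 : ℝ) / ((r : ℝ) - 1)) ≤ (periodGrowth m GA ω ⌊C * x⌋₊ : ℝ) := by
  have haa : a * a = 1 := by
    have h := pow_orderOf_eq_one a
    rwa [ha2, pow_two] at h
  have haq' : a (qtop m) = qone m := by
    rw [← haq, ← Equiv.Perm.mul_apply, haa, Equiv.Perm.one_apply]
  have h0I : (0 : ℕ) ∈ I := by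
    rw [hI]
    exact Or.inl rfl
  have hr : 2 ≤ r := by
    obtain ⟨j, hj, hj0, hjr⟩ := hgap 0 h0I
    rw [hI] at hj
    rcases hj with h | ⟨-, h1, h2⟩
    · exact absurd h hj0.ne'
    · by_contra hlt
      apply h2
      rw [show j - 1 = 0 by omega, h1]
  have hr' : (1 : ℝ) ≤ (r : ℝ) - 1 := by
    have : (2 : ℝ) ≤ r := by exact_mod_cast hr
    linarith
  set R : ℕ := 2 ^ (r - 1) with hR
  have hR1 : 1 < R := Nat.one_lt_two_pow (by omega)
  have key : ∀ K n : ℕ, 4 * R ^ K ≤ n → 2 ^ K ≤ periodGrowth m GA ω n := by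
    intro K n hn
    obtain ⟨k, hk, ys, d, hlen, -, -, hdvd⟩ :=
      exists_hasOddWord haq haq' haa hI hgap hK1 hK2 K 0 h0I
    obtain ⟨hmem, hwl⟩ := altElem_mem_and_wordLength_le m GA ω ha (ys ++ [d])
    have hfin : IsOfFinOrder (altElem m ω a 0 (ys ++ [d])) := by
      rw [altElem_eq_evalWord]
      exact isOfFinOrder_evalWord m ω hdata.kernels_cover 0 _
    refine (Nat.le_of_dvd hfin.orderOf_pos hdvd).trans
      (orderOf_le_periodGrowth m GA ω hmem (hwl.trans ?_))
    have hl : (ys ++ [d]).length = 2 * k + 1 := by simp [hlen]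
    have hk' : k + 1 ≤ R ^ K := hk
    rw [hl]
    omega
  have hRreal : ((R : ℕ) : ℝ) ^ ((1 : ℝ) / ((r : ℝ) - 1)) = 2 := by
    rw [hR, Nat.cast_pow, Nat.cast_ofNat, ← Real.rpow_natCast, ← Real.rpow_mul two_pos.le,
      Nat.cast_sub (by omega), Nat.cast_one, mul_one_div_cancel (by linarith), Real.rpow_one]
  have hexp : (0 : ℝ) ≤ 1 / ((r : ℝ) - 1) := by positivity
  have hRpos : (0 : ℝ) < R := by exact_mod_cast (by omega : 0 < R)
  refine ⟨4 * R, by positivity, fun x hx => ?_⟩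
  rcases le_total x 1 with hx1 | hx1
  · refine (Real.rpow_le_one hx hx1 hexp).trans ?_
    exact_mod_cast one_le_periodGrowth m GA ω _
  · obtain ⟨K, hK, hK'⟩ := exists_nat_pow_near hx1 (by exact_mod_cast hR1 : (1 : ℝ) < R)
    have hle : 2 ^ (K + 1) ≤ periodGrowth m GA ω ⌊4 * (R : ℝ) * x⌋₊ := by
      refine key _ _ (Nat.le_floor ?_)
      push_cast
      rw [pow_succ]
      nlinarith
    calc x ^ ((1 : ℝ) / ((r : ℝ) - 1))
        ≤ ((R : ℝ) ^ (K + 1)) ^ ((1 : ℝ) / ((r : ℝ) - 1)) :=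
          Real.rpow_le_rpow hx hK'.le hexp
      _ = (2 : ℝ) ^ (K + 1) := by rw [← Real.rpow_pow_comm hRpos.le, hRreal]
      _ ≤ _ := by exact_mod_cast hle
end Spinal
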